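/- arXiv:2205.13566 — 7 statements merged into one kernel-verified Lean document; each statement's English description precedes it below -/
import Mathlib

section
/- Suppose V_0 ≥ 0, V_1 ≥ 0 and V_0, V_1 satisfy the optimality (Bellman) equations V_s = max_{1≤a≤M} Q(s,a) for s ∈ {0,1}. Then V_1 ≥ V_0 and, for every state s ∈ {0,1} and every arm a ∈ {1,…,M}, Q(s,1) ≥ Q(s,a); in particular V_s = Q(s,1) for s ∈ {0,1}, i.e., always pulling the arm a_1 with the largest mean attains the maximum in the Bellman equations (the genie-aided optimal policy always pulls arm a_1). -/
/-- The Q-function expression for the two-state MAB-A model: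
`Q(s, a) = μ_a + (1−μ_a)*(1−q(s,0))*V₀ + μ_a*(1−q(s,1))*V₁`. -/
noncomputable def Qfun (μ : ℕ → ℝ) (q : ℕ → ℕ → ℝ) (V0 V1 : ℝ) (s a : ℕ) : ℝ :=
  μ a + (1 - μ a) * (1 - q s 0) * V0 + μ a * (1 - q s 1) * V1

/-- Lemma 1: if `V₀, V₁ ≥ 0` satisfy the Bellman optimality equations
`V_s = max_{1 ≤ a ≤ M} Q(s,a)` for `s ∈ {0,1}`, then `V₁ ≥ V₀`, arm `1` maximizes
`Q(s,·)` for every state, and `V_s = Q(s,1)`: the genie-aided optimal policy always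
pulls the arm with the largest mean. -/
theorem stmt_1
    (M : ℕ) (hM : 2 ≤ M)
    (μ : ℕ → ℝ)
    (hμ01 : ∀ a, 1 ≤ a → a ≤ M → 0 ≤ μ a ∧ μ a ≤ 1)
    (hμmono : ∀ a b, 1 ≤ a → a ≤ b → b ≤ M → μ b ≤ μ a)
    (q : ℕ → ℕ → ℝ)
    (hq01 : ∀ i j, i ≤ 1 → j ≤ 1 → 0 ≤ q i j ∧ q i j ≤ 1)
    (hqmono : ∀ i j i' j', i ≤ 1 → j ≤ 1 → i' ≤ 1 → j' ≤ 1 → i + j < i' + j' →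
      q i' j' ≤ q i j)
    (V0 V1 : ℝ) (hV0 : 0 ≤ V0) (hV1 : 0 ≤ V1)
    (hne : (Finset.Icc 1 M).Nonempty)
    (hBell0 : V0 = (Finset.Icc 1 M).sup' hne (Qfun μ q V0 V1 0))
    (hBell1 : V1 = (Finset.Icc 1 M).sup' hne (Qfun μ q V0 V1 1)) :
    V0 ≤ V1
      ∧ (∀ s, s ≤ 1 → ∀ a, 1 ≤ a → a ≤ M →
          Qfun μ q V0 V1 s a ≤ Qfun μ q V0 V1 s 1)
      ∧ V0 = Qfun μ q V0 V1 0 1 ∧ V1 = Qfun μ q V0 V1 1 1 := by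
  have hle : V0 ≤ V1 := by
    refine hBell0.le.trans ?_
    apply Finset.sup'_le
    intro a ha
    have h1 : Qfun μ q V0 V1 1 a ≤ V1 := by
      exact (Finset.le_sup' (Qfun μ q V0 V1 1) ha).trans hBell1.ge
    refine le_trans ?_ h1
    obtain ⟨ha1, ha2⟩ := Finset.mem_Icc.mp ha
    obtain ⟨m0, m1⟩ := hμ01 a ha1 ha2
    have e0 := hqmono 0 0 1 0 (by simp) (by simp) (by simp) (by simp) (by simp)
    have e1 := hqmono 0 1 1 1 (by simp) (by simp) (by simp) (by simp) (by simp)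
    have p0 := mul_nonneg (mul_nonneg (sub_nonneg.2 m1) (sub_nonneg.2 e0)) hV0
    have p1 := mul_nonneg (mul_nonneg m0 (sub_nonneg.2 e1)) hV1
    unfold Qfun
    linarith
  have hQ : ∀ s, s ≤ 1 → ∀ a, 1 ≤ a → a ≤ M →
      Qfun μ q V0 V1 s a ≤ Qfun μ q V0 V1 s 1 := by
    intro s hs a ha1 ha2
    have hm := hμmono 1 a le_rfl ha1 ha2
    have e := hqmono s 0 s 1 hs (by simp) hs (by simp) (by simp)
    have b := (hq01 s 1 hs le_rfl).2
    have k : (1 - q s 0) * V0 ≤ (1 - q s 1) * V1 :=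
      mul_le_mul (by linarith) hle hV0 (by linarith)
    have p := mul_nonneg (sub_nonneg.2 hm)
      (show 0 ≤ 1 + ((1 - q s 1) * V1 - (1 - q s 0) * V0) by linarith)
    unfold Qfun
    linarith
  have key : ∀ s, s ≤ 1 →
      (Finset.Icc 1 M).sup' hne (Qfun μ q V0 V1 s) = Qfun μ q V0 V1 s 1 := by
    intro s hs
    apply le_antisymm
    · apply Finset.sup'_le
      intro a ha
      obtain ⟨ha1, ha2⟩ := Finset.mem_Icc.mp ha
      exact hQ s hs a ha1 ha2
    · exact Finset.le_sup' (Qfun μ q V0 V1 s) (Finset.mem_Icc.mpr ⟨le_rfl, by omega⟩)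
  exact ⟨hle, hQ, hBell0.trans (key 0 (by simp)), hBell1.trans (key 1 le_rfl)⟩
end

section
/- Assume μ_1 > 0, q(1,1) < 1 and q(1,0) < 1, and suppose V_0 ≥ 0, V_1 ≥ 0 satisfy the Bellman equations of the always-pull-a_1 policy, V_s = μ_1 + μ_1·(1−q(s,1))·V_1 + (1−μ_1)·(1−q(s,0))·V_0 for s ∈ {0,1}. Then V_1 ≥ μ_1 > 0 and V_0 / V_1 ≥ min{ (1−q(0,1))/(1−q(1,1)), (1−q(0,0))/(1−q(1,0)) }. -/
/-- if `μ₁ > 0`, `q(1,1) < 1`, `q(1,0) < 1`, and `V₀, V₁ ≥ 0` satisfy the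
Bellman equations of the always-pull-a₁ policy
`V_s = μ₁ + μ₁(1−q(s,1))V₁ + (1−μ₁)(1−q(s,0))V₀` for `s ∈ {0,1}`, then `V₁ ≥ μ₁ > 0`
and `V₀/V₁ ≥ min{(1−q(0,1))/(1−q(1,1)), (1−q(0,0))/(1−q(1,0))}`. -/
theorem stmt_4
    (μ1 : ℝ) (hμ1pos : 0 < μ1) (hμ1le : μ1 ≤ 1)
    (q : ℕ → ℕ → ℝ)
    (hq01 : ∀ i j, i ≤ 1 → j ≤ 1 → 0 ≤ q i j ∧ q i j ≤ 1)
    (hqmono : ∀ i j i' j', i ≤ 1 → j ≤ 1 → i' ≤ 1 → j' ≤ 1 → i + j < i' + j' →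
      q i' j' ≤ q i j)
    (hq11 : q 1 1 < 1) (hq10 : q 1 0 < 1)
    (V0 V1 : ℝ) (hV0 : 0 ≤ V0) (hV1 : 0 ≤ V1)
    (hBell0 : V0 = μ1 + μ1 * (1 - q 0 1) * V1 + (1 - μ1) * (1 - q 0 0) * V0)
    (hBell1 : V1 = μ1 + μ1 * (1 - q 1 1) * V1 + (1 - μ1) * (1 - q 1 0) * V0) :
    μ1 ≤ V1 ∧ 0 < V1
      ∧ min ((1 - q 0 1) / (1 - q 1 1)) ((1 - q 0 0) / (1 - q 1 0)) ≤ V0 / V1 := by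
  have a : 0 < 1 - q 1 1 := by linarith
  have b : 0 < 1 - q 1 0 := by linarith
  have hm : 0 ≤ 1 - μ1 := by linarith
  have h1 : 0 ≤ μ1 * (1 - q 1 1) * V1 := by positivity
  have h2 : 0 ≤ (1 - μ1) * (1 - q 1 0) * V0 := by positivity
  have hle : μ1 ≤ V1 := by linarith
  have hpos : 0 < V1 := by linarith
  refine ⟨hle, hpos, ?_⟩
  rw [le_div_iff₀ hpos]
  have m1 := min_le_left ((1 - q 0 1) / (1 - q 1 1)) ((1 - q 0 0) / (1 - q 1 0))
  have m2 := min_le_right ((1 - q 0 1) / (1 - q 1 1)) ((1 - q 0 0) / (1 - q 1 0))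
  generalize min ((1 - q 0 1) / (1 - q 1 1)) ((1 - q 0 0) / (1 - q 1 0)) = m at m1 m2 ⊢
  rw [le_div_iff₀ a] at m1
  rw [le_div_iff₀ b] at m2
  have hq : q 1 1 ≤ q 0 1 := hqmono 0 1 1 1 (by norm_num) (by norm_num) (by norm_num)
    (by norm_num) (by norm_num)
  have hm1 : m ≤ 1 := by
    by_contra h
    push Not at h
    nlinarith
  have e1 : m * μ1 ≤ μ1 := by nlinarith
  have e2 := mul_le_mul_of_nonneg_left m1 (mul_nonneg hμ1pos.le hV1)
  have e3 := mul_le_mul_of_nonneg_left m2 (mul_nonneg hm hV0)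
  have e4 : m * V1 = m * (μ1 + μ1 * (1 - q 1 1) * V1 + (1 - μ1) * (1 - q 1 0) * V0) := by
    rw [← hBell1]
  linarith
end

section
/- (Lemma 2, sufficient condition.) Assume μ_1 > 0, q(1,1) < 1, q(1,0) ≠ q(0,0), and the ratio condition (q(0,1)−q(1,1))/(q(0,0)−q(1,0)) ≤ min{ (1−q(0,1))/(1−q(1,1)), (1−q(0,0))/(1−q(1,0)) }. Suppose V_0 ≥ 0, V_1 ≥ 0 satisfy the Bellman equations of the always-pull-a_1 policy, V_s = Q(s,1) for s ∈ {0,1}. Then for every arm a ∈ {1,…,M}: V_0 − Q(0,a) ≥ V_1 − Q(1,a). -/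
/-- Lemma 2, sufficient condition: assume `μ₁ > 0`, `q(1,1) < 1`,
`q(1,0) ≠ q(0,0)`, and `(q(0,1)−q(1,1))/(q(0,0)−q(1,0)) ≤
min{(1−q(0,1))/(1−q(1,1)), (1−q(0,0))/(1−q(1,0))}`.  If `V₀, V₁ ≥ 0` satisfy the
Bellman equations of the always-pull-a₁ policy `V_s = Q(s,1)`, then for every arm
`a ∈ {1,…,M}`: `V₀ − Q(0,a) ≥ V₁ − Q(1,a)`. -/
theorem stmt_5
    (M : ℕ) (hM : 2 ≤ M)
    (μ : ℕ → ℝ)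
    (hμ01 : ∀ a, 1 ≤ a → a ≤ M → 0 ≤ μ a ∧ μ a ≤ 1)
    (hμmono : ∀ a b, 1 ≤ a → a ≤ b → b ≤ M → μ b ≤ μ a)
    (q : ℕ → ℕ → ℝ)
    (hq01 : ∀ i j, i ≤ 1 → j ≤ 1 → 0 ≤ q i j ∧ q i j ≤ 1)
    (hqmono : ∀ i j i' j', i ≤ 1 → j ≤ 1 → i' ≤ 1 → j' ≤ 1 → i + j < i' + j' →
      q i' j' ≤ q i j)
    (hμ1pos : 0 < μ 1)
    (hq11 : q 1 1 < 1)
    (hqne : q 1 0 ≠ q 0 0)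
    (hratio : (q 0 1 - q 1 1) / (q 0 0 - q 1 0)
      ≤ min ((1 - q 0 1) / (1 - q 1 1)) ((1 - q 0 0) / (1 - q 1 0)))
    (V0 V1 : ℝ) (hV0 : 0 ≤ V0) (hV1 : 0 ≤ V1)
    (hBell0 : V0 = Qfun μ q V0 V1 0 1)
    (hBell1 : V1 = Qfun μ q V0 V1 1 1)
    (a : ℕ) (ha1 : 1 ≤ a) (haM : a ≤ M) :
    V1 - Qfun μ q V0 V1 1 a ≤ V0 - Qfun μ q V0 V1 0 a := by
  have h1 := hμ01 1 le_rfl (by omega)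
  have hx := hμmono 1 a le_rfl ha1 haM
  have hD : 0 < q 0 0 - q 1 0 := by
    have := hqmono 0 0 1 0 (by norm_num) (by norm_num) (by norm_num) (by norm_num) (by norm_num)
    exact sub_pos.mpr (lt_of_le_of_ne this hqne)
  have hd := hqmono 0 1 1 1 (by norm_num) (by norm_num) (by norm_num) (by norm_num) (by norm_num)
  have h00 := hq01 0 0 (by norm_num) (by norm_num)
  have hp11 : 0 < 1 - q 1 1 := by linarith
  have hp10 : 0 < 1 - q 1 0 := by linarith
  obtain ⟨r, hr⟩ : ∃ r, r = (q 0 1 - q 1 1) / (q 0 0 - q 1 0) := ⟨_, rfl⟩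
  rw [← hr] at hratio
  have hrD : r * (q 0 0 - q 1 0) = q 0 1 - q 1 1 := by
    rw [hr]; exact div_mul_cancel₀ _ hD.ne'
  have hra : r * (1 - q 1 1) ≤ 1 - q 0 1 :=
    (le_div_iff₀ hp11).mp (hratio.trans (min_le_left _ _))
  have hrb : r * (1 - q 1 0) ≤ 1 - q 0 0 :=
    (le_div_iff₀ hp10).mp (hratio.trans (min_le_right _ _))
  have hr1 : r ≤ 1 := by
    by_contra hc
    push Not at hc
    nlinarith
  unfold Qfun at *
  have e1 : 0 ≤ (1 - r) * μ 1 := mul_nonneg (by linarith) hμ1pos.le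
  have e2 : 0 ≤ ((1 - μ 1) * V0) * (1 - q 0 0 - r * (1 - q 1 0)) :=
    mul_nonneg (mul_nonneg (by linarith) hV0) (by linarith)
  have e3 : 0 ≤ (μ 1 * V1) * (1 - q 0 1 - r * (1 - q 1 1)) :=
    mul_nonneg (mul_nonneg hμ1pos.le hV1) (by linarith)
  have key : 0 ≤ V0 - r * V1 := by
    have : V0 - r * V1 = (1 - r) * μ 1 + ((1 - μ 1) * V0) * (1 - q 0 0 - r * (1 - q 1 0))
      + (μ 1 * V1) * (1 - q 0 1 - r * (1 - q 1 1)) := by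
      linear_combination hBell0 - r * hBell1
    linarith
  have e4 : 0 ≤ (μ 1 - μ a) * ((q 0 0 - q 1 0) * (V0 - r * V1)) :=
    mul_nonneg (by linarith) (mul_nonneg hD.le key)
  have e5 : (μ 1 - μ a) * ((q 0 0 - q 1 0) * (V0 - r * V1)) =
      (μ 1 - μ a) * ((q 0 0 - q 1 0) * V0 - (q 0 1 - q 1 1) * V1) := by
    linear_combination (-(μ 1 - μ a) * V1) * hrD
  rw [e5] at e4
  nlinarith [e4, hBell0, hBell1]
end

section
/- For n ≥ 1 define S_n := Σ_{i=1}^n ε_i X_i and U_n := Σ_{i=1}^n ε_i, and on the event {U_n ≥ 1} define the empirical mean μ̄_n := S_n / U_n. Then for every integer n ≥ 2 and every real δ > 1: P( U_n ≥ 1, μ̄_n < μ, and 2·U_n·(μ − μ̄_n)² > δ ) ≤ e·⌈δ·log n⌉·e^{−δ}. -/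
open MeasureTheory ProbabilityTheory

lemma hoeff_step {Ω : Type*} [m0 : MeasurableSpace Ω] (P : Measure Ω) [IsProbabilityMeasure P]
    (μ l : ℝ) (X : Ω → ℝ) (hX : Measurable X) (h01 : ∀ ω, X ω = 0 ∨ X ω = 1)
    (hm : ∫ ω, X ω ∂P = μ) :
    ∫⁻ ω, ENNReal.ofReal (Real.exp (l * (μ - X ω) - l ^ 2 / 8)) ∂P ≤ 1 := by
  have h := hasSubgaussianMGF_of_mem_Icc (μ := P) (X := X) (a := 0) (b := 1) hX.aemeasurable
    (Filter.Eventually.of_forall fun ω => by rcases h01 ω with h | h <;> simp [h])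
  have h1 := h.mgf_le (-l)
  have h2 := h.integrable_exp_mul (-l)
  rw [hm] at h1 h2
  have e : ∀ ω, Real.exp (l * (μ - X ω) - l ^ 2 / 8)
      = Real.exp (-(l ^ 2 / 8)) * Real.exp (-l * (X ω - μ)) := by
    intro ω; rw [← Real.exp_add]; congr 1; ring
  simp_rw [e]
  rw [← ofReal_integral_eq_lintegral_ofReal (h2.const_mul _)
    (Filter.Eventually.of_forall fun ω => by positivity), integral_const_mul]
  rw [ENNReal.ofReal_le_one]
  unfold mgf at h1
  calc _ ≤ Real.exp (-(l ^ 2 / 8)) * _ := mul_le_mul_of_nonneg_left h1 (by positivity)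
    _ = 1 := by
      rw [← Real.exp_add, Real.exp_eq_one_iff]
      norm_num
      ring

lemma slice_bound (δ L z u a : ℝ) (hδ : 1 < δ) (hu : 0 < u) (hz : 0 < z)
    (h : δ * u < 2 * z ^ 2) (h1 : Real.exp (a / δ) ≤ u) (h2 : u ≤ Real.exp ((a + 1) / δ))
    (hL : L = √(8 * δ) * Real.exp (-((a + 1) / (2 * δ)))) :
    δ - 1 ≤ L * z - L ^ 2 * u / 8 := by
  have hδ0 : 0 < δ := by linarith
  set y := √u * Real.exp (-((a + 1) / (2 * δ))) with hy
  have hsu : √u ^ 2 = u := Real.sq_sqrt hu.le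
  have hE : Real.exp (-((a + 1) / (2 * δ))) ^ 2 = Real.exp (-((a + 1) / δ)) := by
    rw [← Real.exp_nat_mul]; congr 1; push_cast; field_simp
  have hy2 : y ^ 2 = u * Real.exp (-((a + 1) / δ)) := by rw [hy, mul_pow, hsu, hE]
  have hy0 : 0 < y := by positivity
  have hyle : y ^ 2 ≤ 1 := by
    rw [hy2]
    calc _ ≤ Real.exp ((a + 1) / δ) * Real.exp (-((a + 1) / δ)) := by gcongr
      _ = 1 := by rw [← Real.exp_add]; simp
  have hyge : 1 - 1 / δ ≤ y ^ 2 := by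
    rw [hy2]
    calc _ ≤ Real.exp (-(1 / δ)) := by linarith [Real.add_one_le_exp (-(1 / δ))]
      _ = Real.exp (a / δ) * Real.exp (-((a + 1) / δ)) := by
        rw [← Real.exp_add]; congr 1; field_simp; ring
      _ ≤ _ := by gcongr
  have hL2 : L ^ 2 * u = 8 * δ * y ^ 2 := by
    rw [hL, mul_pow, Real.sq_sqrt (by positivity), hE, hy2]; ring
  have hL0 : 0 < L := by rw [hL]; positivity
  have hLz : 2 * δ * y ≤ L * z := by
    refine le_of_sq_le_sq ?_ (by positivity)
    nlinarith [mul_pos hL0 hL0]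
  rw [hL2]
  have hy1 : y ≤ 1 := by nlinarith
  have : δ * y ^ 2 ≥ δ - 1 := by
    have := mul_le_mul_of_nonneg_left hyge hδ0.le
    have e : δ * (1 - 1 / δ) = δ - 1 := by field_simp
    linarith
  nlinarith [mul_nonneg hy0.le (sub_nonneg.2 hy1), mul_nonneg hδ0.le (mul_nonneg hy0.le (sub_nonneg.2 hy1))]

lemma supermart {Ω : Type*} [m0 : MeasurableSpace Ω] (P : Measure Ω) [IsProbabilityMeasure P]
    (ℱ : Filtration ℕ m0) (μ : ℝ) (X ε : ℕ → Ω → ℝ)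
    (hX01 : ∀ n ω, X (n + 1) ω = 0 ∨ X (n + 1) ω = 1)
    (hXmeas : ∀ n, Measurable[ℱ (n + 1)] (X (n + 1)))
    (hXmean : ∀ n, ∫ ω, X (n + 1) ω ∂P = μ)
    (hXindep : ∀ n,
      Indep (MeasurableSpace.comap (X (n + 1)) (borel ℝ)) (ℱ n) P)
    (hε01 : ∀ n ω, ε (n + 1) ω = 0 ∨ ε (n + 1) ω = 1)
    (hεmeas : ∀ n, Measurable[ℱ n] (ε (n + 1))) (l : ℝ) (W : ℕ → Ω → ENNReal)
    (hW : ∀ n ω, W n ω = ENNReal.ofReal (Real.exp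
      (∑ i ∈ Finset.Icc 1 n, ε i ω * (l * (μ - X i ω) - l ^ 2 / 8)))) (n : ℕ) :
    Measurable[ℱ n] (W n) ∧ ∫⁻ ω, W n ω ∂P ≤ 1 := by
  have hW' : ∀ n, W n = fun ω => ENNReal.ofReal (Real.exp
      (∑ i ∈ Finset.Icc 1 n, ε i ω * (l * (μ - X i ω) - l ^ 2 / 8))) := fun n => funext (hW n)
  have hmeas : ∀ n, Measurable[ℱ n] (W n) := by
    intro n
    rw [hW']
    refine ENNReal.measurable_ofReal.comp (Real.measurable_exp.comp ?_)
    refine Finset.measurable_fun_sum _ fun i hi => ?_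
    obtain ⟨h1, h2⟩ := Finset.mem_Icc.1 hi
    obtain ⟨j, rfl⟩ : ∃ j, i = j + 1 := ⟨i - 1, by omega⟩
    have a : Measurable[ℱ n] (ε (j + 1)) := (hεmeas j).mono (ℱ.mono (by omega)) le_rfl
    have b : Measurable[ℱ n] (X (j + 1)) := (hXmeas j).mono (ℱ.mono h2) le_rfl
    exact a.mul (((measurable_const.sub b).const_mul l).sub measurable_const)
  refine ⟨hmeas n, ?_⟩
  induction n with
  | zero => simp [hW]
  | succ n ih =>
    set g : Ω → ENNReal := fun ω =>
      ENNReal.ofReal (Real.exp (l * (μ - X (n + 1) ω) - l ^ 2 / 8)) with hg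
    have hstep : ∀ ω, W (n + 1) ω = W n ω * ENNReal.ofReal (1 - ε (n + 1) ω)
        + (W n ω * ENNReal.ofReal (ε (n + 1) ω)) * g ω := by
      intro ω
      rw [hW, hW, Finset.sum_Icc_succ_top (by omega), Real.exp_add,
        ENNReal.ofReal_mul (by positivity)]
      rcases hε01 n ω with h | h <;> simp [h, hg]
    have hWn := hmeas n
    have hA : Measurable[ℱ n] (fun ω => W n ω * ENNReal.ofReal (1 - ε (n + 1) ω)) :=
      hWn.mul (ENNReal.measurable_ofReal.comp (measurable_const.sub (hεmeas n)))
    have hB : Measurable[ℱ n] (fun ω => W n ω * ENNReal.ofReal (ε (n + 1) ω)) :=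
      hWn.mul (ENNReal.measurable_ofReal.comp (hεmeas n))
    have hgm : Measurable[MeasurableSpace.comap (X (n + 1)) (borel ℝ)] g := by
      have h0 : Measurable[MeasurableSpace.comap (X (n + 1)) (borel ℝ)] (X (n + 1)) :=
        comap_measurable _
      exact ENNReal.measurable_ofReal.comp (Real.measurable_exp.comp
        (((measurable_const.sub h0).const_mul l).sub measurable_const))
    have hXm : Measurable (X (n + 1)) := (hXmeas n).mono (ℱ.le _) le_rfl
    have hind := lintegral_mul_eq_lintegral_mul_lintegral_of_independent_measurableSpace
      (ℱ.le n) hXm.comap_le (hXindep n).symm hB hgm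
    have hg1 : ∫⁻ ω, g ω ∂P ≤ 1 := hoeff_step P μ l _ hXm (hX01 n) (hXmean n)
    calc ∫⁻ ω, W (n + 1) ω ∂P
        = ∫⁻ ω, W n ω * ENNReal.ofReal (1 - ε (n + 1) ω) ∂P
          + ∫⁻ ω, (W n ω * ENNReal.ofReal (ε (n + 1) ω)) * g ω ∂P := by
          simp_rw [hstep]
          exact lintegral_add_left (hA.mono (ℱ.le n) le_rfl) _
      _ ≤ ∫⁻ ω, W n ω * ENNReal.ofReal (1 - ε (n + 1) ω) ∂P
          + ∫⁻ ω, (W n ω * ENNReal.ofReal (ε (n + 1) ω)) ∂P := by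
          refine add_le_add le_rfl ?_
          refine (le_of_eq hind).trans ?_
          exact mul_le_of_le_one_right' hg1
      _ = ∫⁻ ω, W n ω ∂P := by
          rw [← lintegral_add_left (hA.mono (ℱ.le n) le_rfl)]
          congr 1; funext ω
          rcases hε01 n ω with h | h <;> simp [h]
      _ ≤ 1 := ih

/-- self-normalized deviation bound, cf. Garivier–Cappé peeling:
with `S_n = Σ_{i=1}^n ε_i X_i`, `U_n = Σ_{i=1}^n ε_i`, and empirical mean
`μ̄_n = S_n / U_n` on `{U_n ≥ 1}`, for every `n ≥ 2` and every `δ > 1`,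
`P(U_n ≥ 1, μ̄_n < μ, 2 U_n (μ − μ̄_n)² > δ) ≤ e ⌈δ log n⌉ e^{−δ}`.  Here each `X_i`
is a Bernoulli(μ) reward measurable w.r.t. `𝓕_i` and independent of `𝓕_{i−1}`, and each
selector `ε_i` is `{0,1}`-valued and measurable w.r.t. `𝓕_{i−1}`. -/
theorem stmt_8
    {Ω : Type*} [m0 : MeasurableSpace Ω] (P : Measure Ω) [IsProbabilityMeasure P]
    (ℱ : Filtration ℕ m0)
    (μ : ℝ) (hμ0 : 0 ≤ μ) (hμ1 : μ ≤ 1)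
    (X ε : ℕ → Ω → ℝ)
    (hX01 : ∀ n ω, X (n + 1) ω = 0 ∨ X (n + 1) ω = 1)
    (hXmeas : ∀ n, Measurable[ℱ (n + 1)] (X (n + 1)))
    (hXmean : ∀ n, ∫ ω, X (n + 1) ω ∂P = μ)
    (hXindep : ∀ n,
      Indep (MeasurableSpace.comap (X (n + 1)) (borel ℝ)) (ℱ n) P)
    (hε01 : ∀ n ω, ε (n + 1) ω = 0 ∨ ε (n + 1) ω = 1)
    (hεmeas : ∀ n, Measurable[ℱ n] (ε (n + 1)))
    (S U : ℕ → Ω → ℝ)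
    (hS : ∀ n ω, S n ω = ∑ i ∈ Finset.Icc 1 n, ε i ω * X i ω)
    (hU : ∀ n ω, U n ω = ∑ i ∈ Finset.Icc 1 n, ε i ω)
    (n : ℕ) (hn : 2 ≤ n) (δ : ℝ) (hδ : 1 < δ) :
    P {ω | 1 ≤ U n ω ∧ S n ω / U n ω < μ
        ∧ δ < 2 * U n ω * (μ - S n ω / U n ω) ^ 2}
      ≤ ENNReal.ofReal
          (Real.exp 1 * (⌈δ * Real.log n⌉ : ℝ) * Real.exp (-δ)) := by
  have hδ0 : 0 < δ := by linarith
  set D : ℕ := ⌈δ * Real.log n⌉₊ with hD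
  have hlogn : 0 ≤ δ * Real.log n := mul_nonneg hδ0.le (Real.log_natCast_nonneg n)
  have hDc : ((⌈δ * Real.log n⌉ : ℤ) : ℝ) = D := (natCast_ceil_eq_intCast_ceil hlogn).symm
  set L : ℕ → ℝ := fun k => √(8 * δ) * Real.exp (-(((k : ℝ) + 1) / (2 * δ))) with hL
  set W : ℕ → ℕ → Ω → ENNReal := fun k n ω => ENNReal.ofReal (Real.exp
      (∑ i ∈ Finset.Icc 1 n, ε i ω * (L k * (μ - X i ω) - L k ^ 2 / 8))) with hW
  have hsup := fun k => supermart P ℱ μ X ε hX01 hXmeas hXmean hXindep hε01 hεmeas (L k) (W k)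
    (fun _ _ => rfl) n
  have hUn : ∀ ω, U n ω ≤ n := by
    intro ω
    rw [hU]
    calc _ ≤ ∑ i ∈ Finset.Icc 1 n, (1 : ℝ) := by
          refine Finset.sum_le_sum fun i hi => ?_
          obtain ⟨j, rfl⟩ : ∃ j, i = j + 1 := ⟨i - 1, by have := Finset.mem_Icc.1 hi; omega⟩
          rcases hε01 j ω with h | h <;> simp [h]
      _ = n := by simp
  have hsub : {ω | 1 ≤ U n ω ∧ S n ω / U n ω < μ
        ∧ δ < 2 * U n ω * (μ - S n ω / U n ω) ^ 2}
      ⊆ ⋃ k ∈ Finset.range D, {ω | ENNReal.ofReal (Real.exp (δ - 1)) ≤ W k n ω} := by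
    rintro ω ⟨h1, h2, h3⟩
    have hu : 0 < U n ω := by linarith
    have hlu : 0 ≤ δ * Real.log (U n ω) := mul_nonneg hδ0.le (Real.log_nonneg h1)
    have hle : δ * Real.log (U n ω) ≤ δ * Real.log n := by
      have := hUn ω
      gcongr
    have hlogpos : 0 < δ * Real.log n :=
      mul_pos hδ0 (Real.log_pos (by exact_mod_cast (by omega : 1 < n)))
    have hDpos : 0 < D := Nat.ceil_pos.2 hlogpos
    set k := ⌈δ * Real.log (U n ω)⌉₊ - 1 with hk
    have hkD : k < D := by
      have : ⌈δ * Real.log (U n ω)⌉₊ ≤ D := Nat.ceil_mono hle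
      omega
    have hk1 : (k : ℝ) ≤ δ * Real.log (U n ω) := by
      rcases Nat.eq_zero_or_pos k with h | h
      · rw [h]; simpa using hlu
      · exact (Nat.lt_ceil.1 (by omega)).le
    have hk2 : δ * Real.log (U n ω) ≤ k + 1 := by
      refine (Nat.le_ceil _).trans ?_
      exact_mod_cast (by omega : ⌈δ * Real.log (U n ω)⌉₊ ≤ k + 1)
    simp only [Set.mem_iUnion, Set.mem_setOf_eq, Finset.mem_range, exists_prop]
    refine ⟨k, hkD, ENNReal.ofReal_le_ofReal (Real.exp_le_exp.2 ?_)⟩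
    have hz : 0 < μ * U n ω - S n ω := by
      rw [div_lt_iff₀ hu] at h2; linarith
    have key := slice_bound δ (L k) (μ * U n ω - S n ω) (U n ω) k hδ hu hz
      (by
        have e : μ - S n ω / U n ω = (μ * U n ω - S n ω) / U n ω := by field_simp
        rw [e] at h3
        have e2 : 2 * U n ω * ((μ * U n ω - S n ω) / U n ω) ^ 2
          = 2 * (μ * U n ω - S n ω) ^ 2 / U n ω := by field_simp
        rw [e2, lt_div_iff₀ hu] at h3
        exact h3)
      (by rw [← Real.le_log_iff_exp_le hu, div_le_iff₀ hδ0]; linarith)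
      (by rw [← Real.log_le_iff_le_exp hu, le_div_iff₀ hδ0]; linarith) rfl
    refine key.trans (le_of_eq ?_)
    rw [hU, hS, Finset.mul_sum, ← Finset.sum_sub_distrib, Finset.mul_sum, Finset.mul_sum,
      Finset.sum_div, ← Finset.sum_sub_distrib]
    refine Finset.sum_congr rfl fun i _ => ?_
    ring
  have hMarkov : ∀ k, P {ω | ENNReal.ofReal (Real.exp (δ - 1)) ≤ W k n ω}
      ≤ ENNReal.ofReal (Real.exp (1 - δ)) := by
    intro k
    have h := (mul_meas_ge_le_lintegral ((hsup k).1.mono (ℱ.le n) le_rfl)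
      (ENNReal.ofReal (Real.exp (δ - 1)))).trans (hsup k).2
    calc _ = ENNReal.ofReal (Real.exp (1 - δ)) * (ENNReal.ofReal (Real.exp (δ - 1)) *
          P {ω | ENNReal.ofReal (Real.exp (δ - 1)) ≤ W k n ω}) := by
          rw [← mul_assoc, ← ENNReal.ofReal_mul (by positivity), ← Real.exp_add]
          simp
      _ ≤ _ := mul_le_of_le_one_right' h
  calc _ ≤ P (⋃ k ∈ Finset.range D, {ω | ENNReal.ofReal (Real.exp (δ - 1)) ≤ W k n ω}) :=
        measure_mono hsub
    _ ≤ ∑ k ∈ Finset.range D, P {ω | ENNReal.ofReal (Real.exp (δ - 1)) ≤ W k n ω} :=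
        measure_biUnion_finset_le _ _
    _ ≤ ∑ k ∈ Finset.range D, ENNReal.ofReal (Real.exp (1 - δ)) :=
        Finset.sum_le_sum fun k _ => hMarkov k
    _ = _ := by
        rw [hDc, Finset.sum_const, Finset.card_range, nsmul_eq_mul, sub_eq_add_neg, Real.exp_add,
          mul_right_comm, mul_comm _ (D : ℝ), ENNReal.ofReal_mul (Nat.cast_nonneg D),
          ENNReal.ofReal_natCast]
end

section
/- Define L(s,a) := 1 + μ_a·(1−q(s,1))·J_1 + (1−μ_a)·(1−q(s,0))·J_0 for s ∈ {0,1} and arms a ∈ {1,…,M}. Suppose J_0 ≥ 0, J_1 ≥ 0 and J_s = max_{1≤a≤M} L(s,a) for s ∈ {0,1}. Then J_1 ≥ J_0 and, for every s ∈ {0,1} and every arm a, L(s,1) ≥ L(s,a); hence J_s = L(s,1), i.e., the expected episode length in the MAB-A process is maximized by always pulling the arm a_1 with the largest mean. -/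
/-- The one-step fixed-point expression for the expected episode length when pulling
arm `a` in state `s`: `L(s,a) = 1 + μ_a(1−q(s,1))J₁ + (1−μ_a)(1−q(s,0))J₀`. -/
noncomputable def Lfun (μ : ℕ → ℝ) (q : ℕ → ℕ → ℝ) (J0 J1 : ℝ) (s a : ℕ) : ℝ :=
  1 + μ a * (1 - q s 1) * J1 + (1 - μ a) * (1 - q s 0) * J0

/-- if `J₀, J₁ ≥ 0` satisfy `J_s = max_{1 ≤ a ≤ M} L(s,a)` for
`s ∈ {0,1}`, then `J₁ ≥ J₀`, arm `1` maximizes `L(s,·)` for every state, and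
`J_s = L(s,1)`: the expected episode length is maximized by always pulling the arm
with the largest mean. -/
theorem stmt_9
    (M : ℕ) (hM : 2 ≤ M)
    (μ : ℕ → ℝ)
    (hμ01 : ∀ a, 1 ≤ a → a ≤ M → 0 ≤ μ a ∧ μ a ≤ 1)
    (hμmono : ∀ a b, 1 ≤ a → a ≤ b → b ≤ M → μ b ≤ μ a)
    (q : ℕ → ℕ → ℝ)
    (hq01 : ∀ i j, i ≤ 1 → j ≤ 1 → 0 ≤ q i j ∧ q i j ≤ 1)
    (hqmono : ∀ i j i' j', i ≤ 1 → j ≤ 1 → i' ≤ 1 → j' ≤ 1 → i + j < i' + j' →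
      q i' j' ≤ q i j)
    (J0 J1 : ℝ) (hJ0 : 0 ≤ J0) (hJ1 : 0 ≤ J1)
    (hne : (Finset.Icc 1 M).Nonempty)
    (hBell0 : J0 = (Finset.Icc 1 M).sup' hne (Lfun μ q J0 J1 0))
    (hBell1 : J1 = (Finset.Icc 1 M).sup' hne (Lfun μ q J0 J1 1)) :
    J0 ≤ J1
      ∧ (∀ s, s ≤ 1 → ∀ a, 1 ≤ a → a ≤ M →
          Lfun μ q J0 J1 s a ≤ Lfun μ q J0 J1 s 1)
      ∧ J0 = Lfun μ q J0 J1 0 1 ∧ J1 = Lfun μ q J0 J1 1 1 := by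
  have hle0 : ∀ a, 1 ≤ a → a ≤ M → Lfun μ q J0 J1 0 a ≤ J0 := by
    intro a h1 h2
    have h := Finset.le_sup' (Lfun μ q J0 J1 0) (Finset.mem_Icc.mpr ⟨h1, h2⟩)
    exact h.trans (le_of_eq hBell0.symm)
  have hle1 : ∀ a, 1 ≤ a → a ≤ M → Lfun μ q J0 J1 1 a ≤ J1 := by
    intro a h1 h2
    have h := Finset.le_sup' (Lfun μ q J0 J1 1) (Finset.mem_Icc.mpr ⟨h1, h2⟩)
    exact h.trans (le_of_eq hBell1.symm)
  obtain ⟨a, ha, hae⟩ := Finset.exists_mem_eq_sup' hne (Lfun μ q J0 J1 0)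
  obtain ⟨b, hb, hbe⟩ := Finset.exists_mem_eq_sup' hne (Lfun μ q J0 J1 1)
  have hae' : J0 = Lfun μ q J0 J1 0 a := hBell0.trans hae
  have hbe' : J1 = Lfun μ q J0 J1 1 b := hBell1.trans hbe
  rw [Finset.mem_Icc] at ha hb
  have hJ : J0 ≤ J1 := by
    have h1 := hle1 a ha.1 ha.2
    have hm := hμ01 a ha.1 ha.2
    have q1 : q 1 1 ≤ q 0 1 := hqmono 0 1 1 1 (by simp) (by simp) (by simp) (by simp) (by simp)
    have q2 : q 1 0 ≤ q 0 0 := hqmono 0 0 1 0 (by simp) (by simp) (by simp) (by simp) (by simp)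
    have e1 := mul_nonneg (mul_nonneg hm.1 (sub_nonneg.mpr q1)) hJ1
    have e2 := mul_nonneg (mul_nonneg (sub_nonneg.mpr hm.2) (sub_nonneg.mpr q2)) hJ0
    have h3 : Lfun μ q J0 J1 0 a ≤ Lfun μ q J0 J1 1 a := by
      unfold Lfun
      linarith
    linarith
  have hmax : ∀ s, s ≤ 1 → ∀ a, 1 ≤ a → a ≤ M →
      Lfun μ q J0 J1 s a ≤ Lfun μ q J0 J1 s 1 := by
    intro s hs a h1 h2
    have hm := hμmono 1 a le_rfl h1 h2
    have q1 : q s 1 ≤ q s 0 := hqmono s 0 s 1 hs (by simp) hs (by simp) (by simp)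
    have q2 := (hq01 s 1 hs le_rfl).2
    have e1 : (1 - q s 0) * J0 ≤ (1 - q s 1) * J1 :=
      mul_le_mul (by linarith) hJ hJ0 (by linarith)
    have e2 := mul_nonneg (sub_nonneg.mpr hm) (sub_nonneg.mpr e1)
    unfold Lfun
    linarith
  refine ⟨hJ, hmax, le_antisymm ?_ (hle0 1 le_rfl (by omega)),
    le_antisymm ?_ (hle1 1 le_rfl (by omega))⟩
  · exact hae'.le.trans (hmax 0 (by simp) a ha.1 ha.2)
  · exact hbe'.le.trans (hmax 1 le_rfl b hb.1 hb.2)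
end

section
/- Let V : [0,1] → ℝ be bounded and nonnegative and satisfy the optimality equation V(s) = max_{1≤a≤M} Q_V(s,a) for all s ∈ [0,1]. Then V is monotone nondecreasing on [0,1]: V(s_1) ≥ V(s_2) whenever s_1 ≥ s_2. -/
/-- The Q-function expression for the general-state MAB-A model with forgetting factor
`θ`: `Q_V(s,a) = μ_a + (1−μ_a)(1−q(f₀(s)))V(f₀(s)) + μ_a(1−q(f₁(s)))V(f₁(s))`,
where `f₀(s) = (1−θ)s` and `f₁(s) = (1−θ)s + θ`. -/
noncomputable def Qcont (θ : ℝ) (μ : ℕ → ℝ) (q V : ℝ → ℝ) (s : ℝ) (a : ℕ) : ℝ :=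
  μ a + (1 - μ a) * (1 - q ((1 - θ) * s)) * V ((1 - θ) * s)
    + μ a * (1 - q ((1 - θ) * s + θ)) * V ((1 - θ) * s + θ)

/-- if `V : [0,1] → ℝ` is bounded, nonnegative, and satisfies the
optimality equation `V(s) = max_{1 ≤ a ≤ M} Q_V(s,a)` on `[0,1]`, then `V` is
monotone nondecreasing on `[0,1]`. -/
theorem stmt_10
    (θ : ℝ) (hθ0 : 0 < θ) (hθ1 : θ < 1)
    (M : ℕ) (hM : 2 ≤ M)
    (μ : ℕ → ℝ)
    (hμ01 : ∀ a, 1 ≤ a → a ≤ M → 0 ≤ μ a ∧ μ a ≤ 1)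
    (hμmono : ∀ a b, 1 ≤ a → a ≤ b → b ≤ M → μ b ≤ μ a)
    (q : ℝ → ℝ)
    (hq : ∀ s ∈ Set.Icc (0 : ℝ) 1, 0 < q s ∧ q s ≤ 1)
    (hqanti : ∀ s₁ ∈ Set.Icc (0 : ℝ) 1, ∀ s₂ ∈ Set.Icc (0 : ℝ) 1,
      s₂ ≤ s₁ → q s₁ ≤ q s₂)
    (V : ℝ → ℝ)
    (C : ℝ) (hVbdd : ∀ s ∈ Set.Icc (0 : ℝ) 1, 0 ≤ V s ∧ V s ≤ C)
    (hne : (Finset.Icc 1 M).Nonempty)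
    (hBell : ∀ s ∈ Set.Icc (0 : ℝ) 1,
      V s = (Finset.Icc 1 M).sup' hne (Qcont θ μ q V s)) :
    ∀ s₁ ∈ Set.Icc (0 : ℝ) 1, ∀ s₂ ∈ Set.Icc (0 : ℝ) 1, s₂ ≤ s₁ → V s₂ ≤ V s₁ := by
  have h1 : (1:ℝ) ∈ Set.Icc (0:ℝ) 1 := by simp
  have hc0 := (hq 1 h1).1
  have hc1 := (hq 1 h1).2
  have hC : 0 ≤ C := le_trans (hVbdd 1 h1).1 (hVbdd 1 h1).2
  have aux : ∀ D : ℝ, 0 ≤ D → (∀ s₁ ∈ Set.Icc (0 : ℝ) 1, ∀ s₂ ∈ Set.Icc (0 : ℝ) 1,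
      s₂ ≤ s₁ → V s₂ ≤ V s₁ + D) → ∀ x ∈ Set.Icc (0 : ℝ) 1, ∀ y ∈ Set.Icc (0 : ℝ) 1,
      y ≤ x → (1 - q y) * V y ≤ (1 - q x) * V x + (1 - q 1) * D := by
    intro D hD h x hx y hy hyx
    have e1 := h x hx y hy hyx
    have e2 := hqanti x hx y hy hyx
    have e3 := hqanti 1 h1 y hy hy.2
    have e4 := (hq y hy).2
    have e5 := (hVbdd x hx).1
    have g1 := mul_le_mul_of_nonneg_left e1 (sub_nonneg.2 e4)
    have g2 := mul_nonneg (sub_nonneg.2 e2) e5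
    have g3 := mul_nonneg (sub_nonneg.2 e3) hD
    nlinarith
  have step : ∀ D : ℝ, 0 ≤ D → (∀ s₁ ∈ Set.Icc (0 : ℝ) 1, ∀ s₂ ∈ Set.Icc (0 : ℝ) 1,
      s₂ ≤ s₁ → V s₂ ≤ V s₁ + D) → ∀ s₁ ∈ Set.Icc (0 : ℝ) 1, ∀ s₂ ∈ Set.Icc (0 : ℝ) 1,
      s₂ ≤ s₁ → V s₂ ≤ V s₁ + (1 - q 1) * D := by
    intro D hD h s₁ hs₁ s₂ hs₂ hs
    have m0 : ∀ s ∈ Set.Icc (0 : ℝ) 1, (1 - θ) * s ∈ Set.Icc (0 : ℝ) 1 := by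
      intro s hs
      constructor <;> nlinarith [hs.1, hs.2]
    have m1 : ∀ s ∈ Set.Icc (0 : ℝ) 1, (1 - θ) * s + θ ∈ Set.Icc (0 : ℝ) 1 := by
      intro s hs
      constructor <;> nlinarith [hs.1, hs.2]
    have hm : (1 - θ) * s₂ ≤ (1 - θ) * s₁ :=
      mul_le_mul_of_nonneg_left hs (by linarith)
    have a0 := aux D hD h _ (m0 _ hs₁) _ (m0 _ hs₂) hm
    have a1 := aux D hD h _ (m1 _ hs₁) _ (m1 _ hs₂) (by linarith)
    rw [hBell s₂ hs₂]
    apply Finset.sup'_le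
    intro a ha
    have hle : Qcont θ μ q V s₁ a ≤ V s₁ := by
      rw [hBell s₁ hs₁]
      exact Finset.le_sup' _ ha
    rw [Finset.mem_Icc] at ha
    obtain ⟨p0, p1⟩ := hμ01 a ha.1 ha.2
    have b0 := mul_le_mul_of_nonneg_left a0 (sub_nonneg.2 p1)
    have b1 := mul_le_mul_of_nonneg_left a1 p0
    unfold Qcont at hle ⊢
    linarith
  have key : ∀ n : ℕ, ∀ s₁ ∈ Set.Icc (0 : ℝ) 1, ∀ s₂ ∈ Set.Icc (0 : ℝ) 1,
      s₂ ≤ s₁ → V s₂ ≤ V s₁ + (1 - q 1) ^ n * C := by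
    intro n
    induction n with
    | zero =>
      intro s₁ hs₁ s₂ hs₂ _
      have := (hVbdd s₁ hs₁).1
      have := (hVbdd s₂ hs₂).2
      simp
      linarith
    | succ n ih =>
      have := step _ (mul_nonneg (pow_nonneg (sub_nonneg.2 hc1) n) hC) ih
      intro s₁ hs₁ s₂ hs₂ hs
      have := this s₁ hs₁ s₂ hs₂ hs
      rw [pow_succ']
      linarith
  intro s₁ hs₁ s₂ hs₂ hs
  have ht := ((tendsto_pow_atTop_nhds_zero_of_lt_one (sub_nonneg.2 hc1)
    (by linarith : 1 - q 1 < 1)).mul_const C).const_add (V s₁)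
  simp only [zero_mul, add_zero] at ht
  exact ge_of_tendsto' ht (fun n => key n s₁ hs₁ s₂ hs₂ hs)
end

section
/- (Lemma 3, general-state optimal policy.) Let V : [0,1] → ℝ be bounded and nonnegative and satisfy the optimality equation V(s) = max_{1≤a≤M} Q_V(s,a) for all s ∈ [0,1]. Then for every s ∈ [0,1] and every arm a ∈ {1,…,M}, Q_V(s,1) ≥ Q_V(s,a); in particular V(s) = Q_V(s,1) for all s, i.e., the genie-aided optimal policy always pulls the arm a_1 with the largest mean. -/
/-- Lemma 3, general-state optimal policy: if `V : [0,1] → ℝ` is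
bounded, nonnegative, and satisfies the optimality equation
`V(s) = max_{1 ≤ a ≤ M} Q_V(s,a)` on `[0,1]`, then for every `s ∈ [0,1]` and every
arm `a ∈ {1,…,M}`, `Q_V(s,1) ≥ Q_V(s,a)`; in particular `V(s) = Q_V(s,1)`: the
genie-aided optimal policy always pulls the arm with the largest mean. -/
theorem stmt_11
    (θ : ℝ) (hθ0 : 0 < θ) (hθ1 : θ < 1)
    (M : ℕ) (hM : 2 ≤ M)
    (μ : ℕ → ℝ)
    (hμ01 : ∀ a, 1 ≤ a → a ≤ M → 0 ≤ μ a ∧ μ a ≤ 1)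
    (hμmono : ∀ a b, 1 ≤ a → a ≤ b → b ≤ M → μ b ≤ μ a)
    (q : ℝ → ℝ)
    (hq : ∀ s ∈ Set.Icc (0 : ℝ) 1, 0 < q s ∧ q s ≤ 1)
    (hqanti : ∀ s₁ ∈ Set.Icc (0 : ℝ) 1, ∀ s₂ ∈ Set.Icc (0 : ℝ) 1,
      s₂ ≤ s₁ → q s₁ ≤ q s₂)
    (V : ℝ → ℝ)
    (C : ℝ) (hVbdd : ∀ s ∈ Set.Icc (0 : ℝ) 1, 0 ≤ V s ∧ V s ≤ C)
    (hne : (Finset.Icc 1 M).Nonempty)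
    (hBell : ∀ s ∈ Set.Icc (0 : ℝ) 1,
      V s = (Finset.Icc 1 M).sup' hne (Qcont θ μ q V s)) :
    ∀ s ∈ Set.Icc (0 : ℝ) 1,
      (∀ a, 1 ≤ a → a ≤ M → Qcont θ μ q V s a ≤ Qcont θ μ q V s 1)
        ∧ V s = Qcont θ μ q V s 1 := by
  have h1m : (1 : ℝ) ∈ Set.Icc (0 : ℝ) 1 := ⟨zero_le_one, le_refl 1⟩
  have h0m : (0 : ℝ) ∈ Set.Icc (0 : ℝ) 1 := ⟨le_refl 0, zero_le_one⟩
  have hC : 0 ≤ C := (hVbdd 0 h0m).1.trans (hVbdd 0 h0m).2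
  have hf0 : ∀ s ∈ Set.Icc (0 : ℝ) 1, (1 - θ) * s ∈ Set.Icc (0 : ℝ) 1 := by
    rintro s ⟨h0, h1⟩
    constructor <;> nlinarith
  have hf1 : ∀ s ∈ Set.Icc (0 : ℝ) 1, (1 - θ) * s + θ ∈ Set.Icc (0 : ℝ) 1 := by
    rintro s ⟨h0, h1⟩
    constructor <;> nlinarith
  have hβ0 : 0 ≤ 1 - q 1 := by linarith [(hq 1 h1m).2]
  have hβ1 : 1 - q 1 < 1 := by linarith [(hq 1 h1m).1]
  have hW : ∀ D : ℝ, 0 ≤ D → ∀ x ∈ Set.Icc (0 : ℝ) 1, ∀ y ∈ Set.Icc (0 : ℝ) 1, x ≤ y →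
      V x - V y ≤ D → (1 - q x) * V x - (1 - q y) * V y ≤ (1 - q 1) * D := by
    intro D hD x hx y hy hxy h
    have e1 := hqanti y hy x hx hxy
    have e2 := hqanti 1 h1m x hx hx.2
    have e3 := (hq x hx).2
    have e4 := (hVbdd y hy).1
    have a1 := mul_nonneg (sub_nonneg.2 e1) e4
    have a2 := mul_le_mul_of_nonneg_left h (sub_nonneg.2 e3)
    have a3 := mul_nonneg (sub_nonneg.2 e2) hD
    linarith
  have key : ∀ n : ℕ, ∀ x ∈ Set.Icc (0 : ℝ) 1, ∀ y ∈ Set.Icc (0 : ℝ) 1, x ≤ y →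
      V x - V y ≤ (1 - q 1) ^ n * C := by
    intro n
    induction n with
    | zero =>
      intro x hx y hy _
      have := (hVbdd x hx).2
      have := (hVbdd y hy).1
      simp only [pow_zero, one_mul]
      linarith
    | succ n ih =>
      intro x hx y hy hxy
      have hD : 0 ≤ (1 - q 1) ^ n * C := mul_nonneg (pow_nonneg hβ0 n) hC
      have hm : (1 - θ) * x ≤ (1 - θ) * y :=
        mul_le_mul_of_nonneg_left hxy (by linarith)
      have w0 := hW _ hD _ (hf0 x hx) _ (hf0 y hy) hm (ih _ (hf0 x hx) _ (hf0 y hy) hm)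
      have hm1 : (1 - θ) * x + θ ≤ (1 - θ) * y + θ := by linarith
      have w1 := hW _ hD _ (hf1 x hx) _ (hf1 y hy) hm1 (ih _ (hf1 x hx) _ (hf1 y hy) hm1)
      rw [sub_le_iff_le_add, hBell x hx]
      apply Finset.sup'_le
      intro a ha
      have hy' : Qcont θ μ q V y a ≤ V y := by
        rw [hBell y hy]
        exact Finset.le_sup' _ ha
      rw [Finset.mem_Icc] at ha
      obtain ⟨m0, m1⟩ := hμ01 a ha.1 ha.2
      have b0 := mul_le_mul_of_nonneg_left w0 (sub_nonneg.2 m1)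
      have b1 := mul_le_mul_of_nonneg_left w1 m0
      rw [pow_succ]
      unfold Qcont at hy' ⊢
      linarith
  have hmono : ∀ x ∈ Set.Icc (0 : ℝ) 1, ∀ y ∈ Set.Icc (0 : ℝ) 1, x ≤ y → V x - V y ≤ 0 := by
    intro x hx y hy hxy
    have ht : Filter.Tendsto (fun n : ℕ => (1 - q 1) ^ n * C) Filter.atTop (nhds (0 * C)) :=
      (tendsto_pow_atTop_nhds_zero_of_lt_one hβ0 hβ1).mul_const C
    rw [zero_mul] at ht
    exact ge_of_tendsto' ht (fun n => key n x hx y hy hxy)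
  intro s hs
  have hle : ∀ a, 1 ≤ a → a ≤ M → Qcont θ μ q V s a ≤ Qcont θ μ q V s 1 := by
    intro a ha haM
    have hm : (1 - θ) * s ≤ (1 - θ) * s + θ := by linarith
    have w := hW 0 le_rfl _ (hf0 s hs) _ (hf1 s hs) hm (hmono _ (hf0 s hs) _ (hf1 s hs) hm)
    have hd := hμmono 1 a le_rfl ha haM
    have b := mul_le_mul_of_nonneg_left w (sub_nonneg.2 hd)
    unfold Qcont
    linarith
  refine ⟨hle, ?_⟩
  rw [hBell s hs]
  apply le_antisymm
  · apply Finset.sup'_le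
    intro a ha
    rw [Finset.mem_Icc] at ha
    exact hle a ha.1 ha.2
  · exact Finset.le_sup' _ (Finset.mem_Icc.2 ⟨le_rfl, by omega⟩)
end
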